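/- Let U, V, W be linear subspaces of Euclidean space ℝⁿ, each different from {0}. Then θ(U, W) ≤ θ(U, V) + θ(V, W). -/

import Mathlib

open InnerProductGeometry

/-- The angle between a vector `u` and a linear subspace `V`:
`θ(u,V) := inf{θ(u,v) : v ∈ V, v ≠ 0}`. -/
noncomputable def angleToSub {n : ℕ} (u : EuclideanSpace ℝ (Fin n))
    (V : Submodule ℝ (EuclideanSpace ℝ (Fin n))) : ℝ :=
  sInf {θ : ℝ | ∃ v ∈ V, v ≠ 0 ∧ θ = InnerProductGeometry.angle u v}

/-- The (one-sided) angle between linear subspaces `U` and `V`: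
`θ(U,V) := sup{θ(u,V) : u ∈ U, u ≠ 0}`. -/
noncomputable def subAngle {n : ℕ} (U V : Submodule ℝ (EuclideanSpace ℝ (Fin n))) : ℝ :=
  sSup {θ : ℝ | ∃ u ∈ U, u ≠ 0 ∧ θ = angleToSub u V}

/-- The angles from a vector to the nonzero vectors of a subspace are bounded below by `0`. -/
theorem bddBelow_angles {n : ℕ} (u : EuclideanSpace ℝ (Fin n))
    (V : Submodule ℝ (EuclideanSpace ℝ (Fin n))) :
    BddBelow {θ : ℝ | ∃ v ∈ V, v ≠ 0 ∧ θ = InnerProductGeometry.angle u v} := by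
  refine ⟨0, ?_⟩
  rintro _ ⟨v, -, -, rfl⟩
  exact angle_nonneg u v

theorem angleToSub_le_angle {n : ℕ} (u : EuclideanSpace ℝ (Fin n))
    {V : Submodule ℝ (EuclideanSpace ℝ (Fin n))} {v : EuclideanSpace ℝ (Fin n)}
    (hv : v ∈ V) (hv0 : v ≠ 0) : angleToSub u V ≤ angle u v :=
  csInf_le (bddBelow_angles u V) ⟨v, hv, hv0, rfl⟩

theorem le_angleToSub {n : ℕ} {u : EuclideanSpace ℝ (Fin n)}
    {V : Submodule ℝ (EuclideanSpace ℝ (Fin n))} (hV : V ≠ ⊥) {c : ℝ}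
    (h : ∀ v ∈ V, v ≠ 0 → c ≤ angle u v) : c ≤ angleToSub u V := by
  obtain ⟨v, hv, hv0⟩ := V.exists_mem_ne_zero_of_ne_bot hV
  refine le_csInf ⟨_, v, hv, hv0, rfl⟩ ?_
  rintro _ ⟨v, hv, hv0, rfl⟩
  exact h v hv hv0

theorem angleToSub_le_subAngle {n : ℕ} {U V : Submodule ℝ (EuclideanSpace ℝ (Fin n))}
    (hV : V ≠ ⊥) {u : EuclideanSpace ℝ (Fin n)} (hu : u ∈ U) (hu0 : u ≠ 0) :
    angleToSub u V ≤ subAngle U V := by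
  obtain ⟨v, hv, hv0⟩ := V.exists_mem_ne_zero_of_ne_bot hV
  refine le_csSup ⟨Real.pi, ?_⟩ ⟨u, hu, hu0, rfl⟩
  rintro _ ⟨u, -, -, rfl⟩
  exact (angleToSub_le_angle u hv hv0).trans (angle_le_pi u v)

theorem angleToSub_le_angle_add_angleToSub {n : ℕ} (u v : EuclideanSpace ℝ (Fin n))
    {W : Submodule ℝ (EuclideanSpace ℝ (Fin n))} (hW : W ≠ ⊥) :
    angleToSub u W ≤ angle u v + angleToSub v W := by
  rw [← sub_le_iff_le_add']
  refine le_angleToSub hW fun w hw hw0 => ?_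
  linarith [angleToSub_le_angle u hw hw0, angle_le_angle_add_angle u v w]

/-- One-sided triangle inequality for the subspace angle:
`θ(U, W) ≤ θ(U, V) + θ(V, W)` for nonzero subspaces `U, V, W`. -/
theorem subspace_angle_triangle {n : ℕ}
    (U V W : Submodule ℝ (EuclideanSpace ℝ (Fin n)))
    (hU : U ≠ ⊥) (hV : V ≠ ⊥) (hW : W ≠ ⊥) :
    subAngle U W ≤ subAngle U V + subAngle V W := by
  obtain ⟨u, hu, hu0⟩ := U.exists_mem_ne_zero_of_ne_bot hU
  refine csSup_le ⟨_, u, hu, hu0, rfl⟩ ?_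
  rintro _ ⟨u, hu, hu0, rfl⟩
  have key : angleToSub u W - subAngle V W ≤ angleToSub u V :=
    le_angleToSub hV fun v hv hv0 => by
      linarith [angleToSub_le_angle_add_angleToSub u v hW,
        angleToSub_le_subAngle hW hv hv0]
  linarith [angleToSub_le_subAngle hV hu hu0]
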